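/- arXiv:1409.2387 — 2 statements merged into one kernel-verified Lean document; each statement's English description precedes it below -/
import Mathlib

section
/- Let δ > 0, let ρ : (0,δ] → (0,∞) be continuous, let R > 0 and 0 < ε < 1, and assume 2R · ∫₀^δ ρ(r)⁻¹ (∫_r^δ ρ(s) ds) dr ≤ ε. Then for every complex number z with |z| < R there exists a continuous function u_z : [0,δ] → ℂ such that u_z(x) = 1 + 2z ∫₀^x ρ(r)⁻¹ (∫_r^δ u_z(s) ρ(s) ds) dr for all x ∈ [0,δ], sup_{x∈[0,δ]} |u_z(x)| ≤ 1/(1−ε), and for each fixed x ∈ [0,δ] the map z ↦ u_z(x) is analytic on the disc B_R = {z ∈ ℂ : |z| < R}. -/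
open MeasureTheory Set

/-- Continuity of the inner kernel `r ↦ ρ(r)⁻¹ ∫_r^δ f ρ` on `(0, δ]`. -/
lemma kernel_continuousOn {δ : ℝ} {ρ : ℝ → ℝ}
    (hρc : ContinuousOn ρ (Ioc 0 δ)) (hρpos : ∀ t ∈ Ioc (0:ℝ) δ, 0 < ρ t)
    {f : ℝ → ℂ} (hf : Continuous f) :
    ContinuousOn (fun r => ((ρ r : ℂ))⁻¹ * ∫ s in Ioc r δ, f s * (ρ s : ℂ)) (Ioc 0 δ) := by
  have hρC : ContinuousOn (fun r => (ρ r : ℂ)) (Ioc 0 δ) :=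
    Complex.continuous_ofReal.comp_continuousOn hρc
  refine ContinuousOn.mul (hρC.inv₀ fun t ht => ?_) ?_
  · exact_mod_cast (hρpos t ht).ne'
  · intro r hr
    have ha : 0 < r / 2 := by linarith [hr.1]
    have had : r / 2 ≤ δ := by linarith [hr.1, hr.2]
    have hsub : Icc (r / 2) δ ⊆ Ioc 0 δ := fun t ht => ⟨lt_of_lt_of_le ha ht.1, ht.2⟩
    have hint : IntegrableOn (fun s => f s * (ρ s : ℂ)) (uIcc (r / 2) δ) := by
      rw [uIcc_of_le had]
      exact (hf.continuousOn.mul (hρC.mono hsub)).integrableOn_Icc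
    have h1 := intervalIntegral.continuousOn_primitive_interval_left hint
    rw [uIcc_of_le had] at h1
    have h2 : ContinuousOn (fun r => ∫ s in Ioc r δ, f s * (ρ s : ℂ)) (Icc (r / 2) δ) := by
      refine h1.congr fun t ht => ?_
      exact (intervalIntegral.integral_of_le ht.2).symm
    refine (h2 r ⟨by linarith [hr.1], hr.2⟩).mono_of_mem_nhdsWithin ?_
    have : Ioi (r / 2) ∈ nhds r := Ioi_mem_nhds (by linarith [hr.1])
    filter_upwards [mem_nhdsWithin_of_mem_nhds this, self_mem_nhdsWithin] with t ht ht'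
    exact ⟨le_of_lt ht, ht'.2⟩

lemma kernel_bound {δ : ℝ} {ρ : ℝ → ℝ}
    (hρc : ContinuousOn ρ (Ioc 0 δ)) (hρpos : ∀ t ∈ Ioc (0:ℝ) δ, 0 < ρ t)
    {f : ℝ → ℂ} {M : ℝ} (hM : ∀ s, ‖f s‖ ≤ M) {r : ℝ} (hr : r ∈ Ioc 0 δ) :
    ‖((ρ r : ℂ))⁻¹ * ∫ s in Ioc r δ, f s * (ρ s : ℂ)‖ ≤
      M * ((ρ r)⁻¹ * ∫ s in Ioc r δ, ρ s) := by
  have hr0 := hρpos r hr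
  have hsub : Icc r δ ⊆ Ioc 0 δ := fun t ht => ⟨lt_of_lt_of_le hr.1 ht.1, ht.2⟩
  have hint : IntegrableOn ρ (Ioc r δ) :=
    (hρc.mono hsub).integrableOn_Icc.mono_set Ioc_subset_Icc_self
  have h1 : ‖∫ s in Ioc r δ, f s * (ρ s : ℂ)‖ ≤ ∫ s in Ioc r δ, M * ρ s := by
    refine norm_integral_le_of_norm_le (hint.const_mul M) ?_
    refine (ae_restrict_iff' measurableSet_Ioc).2 (Filter.Eventually.of_forall fun s hs => ?_)
    have hs0 := hρpos s (hsub ⟨hs.1.le, hs.2⟩)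
    rw [norm_mul, Complex.norm_real, Real.norm_of_nonneg hs0.le]
    exact mul_le_mul_of_nonneg_right (hM s) hs0.le
  rw [integral_const_mul] at h1
  rw [norm_mul, norm_inv, Complex.norm_real, Real.norm_of_nonneg hr0.le]
  calc (ρ r)⁻¹ * ‖∫ s in Ioc r δ, f s * (ρ s : ℂ)‖
      ≤ (ρ r)⁻¹ * (M * ∫ s in Ioc r δ, ρ s) := by gcongr
    _ = _ := by ring

lemma kernel_integrable {δ : ℝ} {ρ : ℝ → ℝ}
    (hρc : ContinuousOn ρ (Ioc 0 δ)) (hρpos : ∀ t ∈ Ioc (0:ℝ) δ, 0 < ρ t)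
    (hI : IntegrableOn (fun r => (ρ r)⁻¹ * ∫ s in Ioc r δ, ρ s) (Ioc 0 δ))
    {f : ℝ → ℂ} (hf : Continuous f) {M : ℝ} (hM : ∀ s, ‖f s‖ ≤ M) :
    IntegrableOn (fun r => ((ρ r : ℂ))⁻¹ * ∫ s in Ioc r δ, f s * (ρ s : ℂ)) (Ioc 0 δ) := by
  refine Integrable.mono' (hI.const_mul M)
    ((kernel_continuousOn hρc hρpos hf).aestronglyMeasurable measurableSet_Ioc) ?_
  exact (ae_restrict_iff' measurableSet_Ioc).2
    (Filter.Eventually.of_forall fun s hs => kernel_bound hρc hρpos hM hs)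

/-- The integral operator as a bounded operator on `C([0,δ], ℂ)`. -/
lemma exists_operator {δ : ℝ} (hδ : 0 < δ) {ρ : ℝ → ℝ}
    (hρc : ContinuousOn ρ (Ioc 0 δ)) (hρpos : ∀ t ∈ Ioc (0:ℝ) δ, 0 < ρ t)
    (hI : IntegrableOn (fun r => (ρ r)⁻¹ * ∫ s in Ioc r δ, ρ s) (Ioc 0 δ)) :
    ∃ T : C(Icc (0:ℝ) δ, ℂ) →L[ℂ] C(Icc (0:ℝ) δ, ℂ),
      (‖T‖ ≤ ∫ r in Ioc 0 δ, (ρ r)⁻¹ * ∫ s in Ioc r δ, ρ s) ∧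
      ∀ f x, T f x = ∫ r in Ioc 0 (x:ℝ), ((ρ r : ℂ))⁻¹ *
        ∫ s in Ioc r δ, IccExtend hδ.le f s * (ρ s : ℂ) := by
  have hcont : ∀ f : C(Icc (0:ℝ) δ, ℂ), Continuous (IccExtend hδ.le f) :=
    fun f => f.continuous.Icc_extend'
  have hbd : ∀ (f : C(Icc (0:ℝ) δ, ℂ)) (s : ℝ), ‖IccExtend hδ.le f s‖ ≤ ‖f‖ :=
    fun f s => f.norm_coe_le_norm _
  have hker := fun f : C(Icc (0:ℝ) δ, ℂ) =>
    kernel_integrable hρc hρpos hI (hcont f) (hbd f)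
  have hin : ∀ (f : C(Icc (0:ℝ) δ, ℂ)) (r : ℝ), r ∈ Ioc 0 δ →
      IntegrableOn (fun s => IccExtend hδ.le f s * (ρ s : ℂ)) (Ioc r δ) := by
    intro f r hr
    have hsub : Icc r δ ⊆ Ioc 0 δ := fun t ht => ⟨lt_of_lt_of_le hr.1 ht.1, ht.2⟩
    exact ((hcont f).continuousOn.mul (Complex.continuous_ofReal.comp_continuousOn
      (hρc.mono hsub))).integrableOn_Icc.mono_set Ioc_subset_Icc_self
  have hG0 : ∀ r ∈ Ioc (0:ℝ) δ, 0 ≤ (ρ r)⁻¹ * ∫ s in Ioc r δ, ρ s := by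
    intro r hr
    refine mul_nonneg (inv_nonneg.2 (hρpos r hr).le) ?_
    exact setIntegral_nonneg measurableSet_Ioc fun s hs => (hρpos s ⟨hr.1.trans hs.1, hs.2⟩).le
  have hIoc : ∀ x : Icc (0:ℝ) δ, Ioc 0 (x:ℝ) ⊆ Ioc 0 δ := fun x => Ioc_subset_Ioc_right x.2.2
  have hKc : ∀ f : C(Icc (0:ℝ) δ, ℂ), Continuous fun x : Icc (0:ℝ) δ =>
      ∫ r in Ioc 0 (x:ℝ), ((ρ r : ℂ))⁻¹ *
          ∫ s in Ioc r δ, IccExtend hδ.le f s * (ρ s : ℂ) := by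
    intro f
    have h := intervalIntegral.continuousOn_primitive
      ((integrableOn_Icc_iff_integrableOn_Ioc (by finiteness)).2 (hker f))
    exact h.comp_continuous continuous_subtype_val fun x => x.2
  have hadd : ∀ (f g : C(Icc (0:ℝ) δ, ℂ)) (x : Icc (0:ℝ) δ),
      ∫ r in Ioc 0 (x:ℝ), ((ρ r : ℂ))⁻¹ *
          ∫ s in Ioc r δ, IccExtend hδ.le (f + g : C(Icc (0:ℝ) δ, ℂ)) s * (ρ s : ℂ) =
      (∫ r in Ioc 0 (x:ℝ), ((ρ r : ℂ))⁻¹ *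
          ∫ s in Ioc r δ, IccExtend hδ.le f s * (ρ s : ℂ)) +
      (∫ r in Ioc 0 (x:ℝ), ((ρ r : ℂ))⁻¹ *
          ∫ s in Ioc r δ, IccExtend hδ.le g s * (ρ s : ℂ)) := by
    intro f g x
    rw [← integral_add ((hker f).mono_set (hIoc x)) ((hker g).mono_set (hIoc x))]
    refine setIntegral_congr_fun measurableSet_Ioc fun r hr => ?_
    have hr' := hIoc x hr
    rw [← mul_add, ← integral_add (hin f r hr') (hin g r hr')]
    congr 1
    refine integral_congr_ae (Filter.Eventually.of_forall fun s => ?_)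
    simp [IccExtend, add_mul]
  have hsmul : ∀ (c : ℂ) (f : C(Icc (0:ℝ) δ, ℂ)) (x : Icc (0:ℝ) δ),
      ∫ r in Ioc 0 (x:ℝ), ((ρ r : ℂ))⁻¹ *
          ∫ s in Ioc r δ, IccExtend hδ.le (c • f : C(Icc (0:ℝ) δ, ℂ)) s * (ρ s : ℂ) =
      c * (∫ r in Ioc 0 (x:ℝ), ((ρ r : ℂ))⁻¹ *
          ∫ s in Ioc r δ, IccExtend hδ.le f s * (ρ s : ℂ)) := by
    intro c f x
    rw [← integral_const_mul]
    refine setIntegral_congr_fun measurableSet_Ioc fun r hr => ?_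
    have hc : ∀ s, IccExtend hδ.le (c • f : C(Icc (0:ℝ) δ, ℂ)) s * (ρ s : ℂ) =
        c * (IccExtend hδ.le f s * (ρ s : ℂ)) := fun s => by simp [IccExtend, mul_assoc]
    simp only [hc]
    rw [integral_const_mul, mul_left_comm]
  let L : C(Icc (0:ℝ) δ, ℂ) →ₗ[ℂ] C(Icc (0:ℝ) δ, ℂ) :=
    { toFun := fun f => ⟨_, hKc f⟩
      map_add' := fun f g => ContinuousMap.ext fun x => hadd f g x
      map_smul' := fun c f => ContinuousMap.ext fun x => hsmul c f x }
  have hLb : ∀ f, ‖L f‖ ≤ (∫ r in Ioc 0 δ, (ρ r)⁻¹ * ∫ s in Ioc r δ, ρ s) * ‖f‖ := by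
    intro f
    have hI0 : 0 ≤ ∫ r in Ioc 0 δ, (ρ r)⁻¹ * ∫ s in Ioc r δ, ρ s :=
      setIntegral_nonneg measurableSet_Ioc hG0
    refine (ContinuousMap.norm_le _ (mul_nonneg hI0 (norm_nonneg _))).2 fun x => ?_
    have h1 : ‖L f x‖ ≤ ∫ r in Ioc 0 (x:ℝ), ‖f‖ * ((ρ r)⁻¹ * ∫ s in Ioc r δ, ρ s) := by
      refine norm_integral_le_of_norm_le ((hI.mono_set (hIoc x)).const_mul ‖f‖) ?_
      exact (ae_restrict_iff' measurableSet_Ioc).2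
        (Filter.Eventually.of_forall fun s hs => kernel_bound hρc hρpos (hbd f) (hIoc x hs))
    rw [integral_const_mul] at h1
    have h2 : ∫ r in Ioc 0 (x:ℝ), (ρ r)⁻¹ * ∫ s in Ioc r δ, ρ s ≤
        ∫ r in Ioc 0 δ, (ρ r)⁻¹ * ∫ s in Ioc r δ, ρ s :=
      setIntegral_mono_set hI ((ae_restrict_iff' measurableSet_Ioc).2
        (Filter.Eventually.of_forall hG0)) (hIoc x).eventuallyLE
    calc ‖L f x‖ ≤ _ := h1
      _ ≤ ‖f‖ * _ := mul_le_mul_of_nonneg_left h2 (norm_nonneg _)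
      _ = _ := mul_comm _ _
  refine ⟨L.mkContinuous _ hLb, LinearMap.mkContinuous_norm_le _
    (setIntegral_nonneg measurableSet_Ioc hG0) _, fun f x => rfl⟩

/-- Neumann series solution of `v = e + 2 z T v` in a Banach space. -/
lemma exists_resolvent {E : Type*} [NormedAddCommGroup E] [NormedSpace ℂ E] [CompleteSpace E]
    (T : E →L[ℂ] E) (e : E) {R ε I : ℝ} (hR : 0 < R) (hε1 : ε < 1) (hT : ‖T‖ ≤ I)
    (hsmall : 2 * R * I ≤ ε) :
    ∃ v : ℂ → E, (∀ z ∈ Metric.ball (0:ℂ) R, ∀ w, ‖(2 * z) • T w‖ ≤ ε * ‖w‖) ∧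
      (∀ z ∈ Metric.ball (0:ℂ) R, v z = e + (2 * z) • T (v z)) ∧
      (∀ z ∈ Metric.ball (0:ℂ) R, DifferentiableAt ℂ v z) := by
  have hnorm : ∀ z ∈ Metric.ball (0:ℂ) R, ‖(2 * z) • T‖ ≤ ε := by
    intro z hz
    rw [mem_ball_zero_iff] at hz
    rw [norm_smul, norm_mul, Complex.norm_ofNat]
    refine le_trans ?_ hsmall
    gcongr
  have hunit : ∀ z ∈ Metric.ball (0:ℂ) R, IsUnit (1 - (2 * z) • T) := fun z hz =>
    isUnit_one_sub_of_norm_lt_one ((hnorm z hz).trans_lt hε1)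
  let v : ℂ → E := fun z => Ring.inverse (1 - (2 * z) • T) e
  refine ⟨v, fun z hz w => ?_, fun z hz => ?_, fun z hz => ?_⟩
  · exact ((2 * z) • T).le_of_opNorm_le (hnorm z hz) w
  · have h := congrArg (fun A : E →L[ℂ] E => A e) (Ring.mul_inverse_cancel _ (hunit z hz))
    have h' : v z - (2 * z) • T (v z) = e := h
    exact sub_eq_iff_eq_add.1 h'
  · have hd1 : DifferentiableAt ℂ (fun z : ℂ => 1 - (2 * z) • T) z := by fun_prop
    have hd2 : DifferentiableAt ℂ (fun z : ℂ => Ring.inverse (1 - (2 * z) • T)) z := by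
      have hw' := differentiableAt_inverse (𝕜 := ℂ) (hunit z hz)
      exact hw'.comp z hd1
    exact hd2.clm_apply (differentiableAt_const e)

/-- Iteration construction of a solution of the eigenvalue equation near the singular
endpoint `0`, tending to `1` at `0`, depending analytically on the spectral parameter. -/
theorem exists_analytic_solution_near_zero (δ : ℝ) (hδ : 0 < δ) (ρ : ℝ → ℝ)
    (hρc : ContinuousOn ρ (Ioc 0 δ)) (hρpos : ∀ t ∈ Ioc (0:ℝ) δ, 0 < ρ t)
    (R ε : ℝ) (hR : 0 < R) (hε0 : 0 < ε) (hε1 : ε < 1)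
    (hsmall : 2 * R * (∫ r in Ioc 0 δ, (ρ r)⁻¹ * ∫ s in Ioc r δ, ρ s) ≤ ε) :
    ∃ u : ℂ → ℝ → ℂ,
      (∀ z ∈ Metric.ball (0:ℂ) R,
        ContinuousOn (u z) (Icc 0 δ) ∧
        (∀ x ∈ Icc (0:ℝ) δ,
          u z x = 1 + 2 * z *
            ∫ r in Ioc 0 x, ((ρ r : ℂ))⁻¹ * ∫ s in Ioc r δ, u z s * (ρ s : ℂ)) ∧
        (∀ x ∈ Icc (0:ℝ) δ, ‖u z x‖ ≤ 1 / (1 - ε))) ∧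
      (∀ x ∈ Icc (0:ℝ) δ, AnalyticOnNhd ℂ (fun z => u z x) (Metric.ball 0 R)) := by
  by_cases hI : IntegrableOn (fun r => (ρ r)⁻¹ * ∫ s in Ioc r δ, ρ s) (Ioc 0 δ)
  · obtain ⟨T, hT, hTf⟩ := exists_operator hδ hρc hρpos hI
    obtain ⟨v, hnorm, hv, hvd⟩ := exists_resolvent T (1 : C(Icc (0:ℝ) δ, ℂ)) hR hε1 hT hsmall
    refine ⟨fun z => IccExtend hδ.le (v z), fun z hz => ⟨?_, ?_, ?_⟩, ?_⟩
    · exact (v z).continuous.Icc_extend'.continuousOn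
    · intro x hx
      have h := congrArg (fun f : C(Icc (0:ℝ) δ, ℂ) => f ⟨x, hx⟩) (hv z hz)
      simp only [ContinuousMap.add_apply, ContinuousMap.one_apply, ContinuousMap.smul_apply,
        smul_eq_mul, hTf] at h
      exact (IccExtend_of_mem hδ.le _ hx).trans h
    · intro x hx
      have h1 : ‖v z‖ ≤ 1 + ε * ‖v z‖ := by
        calc ‖v z‖ = ‖1 + (2 * z) • T (v z)‖ := congrArg norm (hv z hz)
          _ ≤ ‖(1 : C(Icc (0:ℝ) δ, ℂ))‖ + ‖(2 * z) • T (v z)‖ := norm_add_le _ _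
          _ ≤ 1 + ε * ‖v z‖ := by
            refine add_le_add ?_ (hnorm z hz _)
            exact (ContinuousMap.norm_le _ zero_le_one).2 fun y => by simp
      have h2 : ‖v z‖ ≤ 1 / (1 - ε) := by
        rw [le_div_iff₀ (by linarith)]; linarith
      exact ((v z).norm_coe_le_norm _).trans h2
    · intro x hx
      refine DifferentiableOn.analyticOnNhd (fun z hz => ?_) Metric.isOpen_ball
      refine DifferentiableAt.differentiableWithinAt ?_
      exact (ContinuousMap.evalCLM ℂ (projIcc 0 δ hδ.le x)).differentiableAt.comp z (hvd z hz)
  · -- the kernel is not integrable near `0`: all outer integrals of `u ≡ 1` take the default value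
    refine ⟨fun _ _ => 1, fun z _ => ⟨continuousOn_const, ?_, ?_⟩, fun x _ => analyticOnNhd_const⟩
    · intro x hx
      have hzero : ∫ r in Ioc 0 x, ((ρ r : ℂ))⁻¹ * ∫ s in Ioc r δ, (1:ℂ) * (ρ s : ℂ) = 0 := by
        rcases hx.1.eq_or_lt with h0 | h0
        · simp [← h0]
        · refine integral_undef fun hint => hI ?_
          have hc := kernel_continuousOn hρc hρpos (f := fun _ => (1:ℂ)) continuous_const
          have hsub : Icc x δ ⊆ Ioc 0 δ := fun t ht => ⟨lt_of_lt_of_le h0 ht.1, ht.2⟩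
          have h1 := ((hc.mono hsub).integrableOn_Icc (μ := volume)).mono_set
            Ioc_subset_Icc_self
          have h2 : IntegrableOn (fun r => ((ρ r : ℂ))⁻¹ * ∫ s in Ioc r δ, (1:ℂ) * (ρ s : ℂ))
              (Ioc 0 δ) := by
            rw [← Ioc_union_Ioc_eq_Ioc hx.1 hx.2]
            exact IntegrableOn.union hint h1
          have h3 := h2.re
          refine h3.congr (Filter.Eventually.of_forall fun r => ?_)
          have : ((ρ r : ℂ))⁻¹ * ∫ s in Ioc r δ, (1:ℂ) * (ρ s : ℂ) =
              (((ρ r)⁻¹ * ∫ s in Ioc r δ, ρ s : ℝ) : ℂ) := by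
            simp only [one_mul]
            rw [integral_complex_ofReal]
            push_cast
            rfl
          simp only [this]
          exact Complex.ofReal_re _
      rw [hzero]; simp
    · intro x _
      rw [norm_one, le_div_iff₀ (by linarith)]
      linarith
end

section
/- Let δ > 0, let b : (0,δ] → ℝ be continuous, fix x₀ ∈ (0,δ) and set ρ(x) := exp(−∫_{x₀}^x 2b(s) ds). Let z ∈ ℂ and let u : [0,δ] → ℂ be continuous with r ↦ ρ(r)⁻¹ ∫_r^δ |u(s)| ρ(s) ds integrable on (0,δ), satisfying u(x) = 1 + 2z ∫₀^x ρ(r)⁻¹ (∫_r^δ u(s) ρ(s) ds) dr for all x ∈ [0,δ]. Then u is twice continuously differentiable on (0,δ), satisfies −(1/2)u''(x) + b(x)u'(x) = z·u(x) for all x ∈ (0,δ), and lim_{x→0⁺} u(x) = 1. -/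
open MeasureTheory Set Filter

/-- A continuous solution of the Volterra integral equation near the singular endpoint `0`
is a twice continuously differentiable solution of the eigenvalue equation
`-(1/2)u'' + b u' = z u` with boundary value `1` at `0`. -/
theorem volterra_solution_solves_ode (δ : ℝ) (hδ : 0 < δ)
    (b : ℝ → ℝ) (hb : ContinuousOn b (Ioc 0 δ))
    (x₀ : ℝ) (hx₀ : x₀ ∈ Ioo 0 δ)
    (ρ : ℝ → ℝ) (hρ : ∀ x, ρ x = Real.exp (-∫ s in x₀..x, 2 * b s))
    (z : ℂ) (u : ℝ → ℂ) (hu : ContinuousOn u (Icc 0 δ))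
    (hint : IntegrableOn (fun r => (ρ r)⁻¹ * ∫ s in Ioc r δ, ‖u s‖ * ρ s)
      (Ioc 0 δ))
    (heq : ∀ x ∈ Icc (0:ℝ) δ,
      u x = 1 + 2 * z * ∫ r in Ioc 0 x, ((ρ r : ℂ))⁻¹ * ∫ s in Ioc r δ, u s * (ρ s : ℂ)) :
    ∃ u' u'' : ℝ → ℂ,
      (∀ x ∈ Ioo (0:ℝ) δ, HasDerivAt u (u' x) x) ∧
      (∀ x ∈ Ioo (0:ℝ) δ, HasDerivAt u' (u'' x) x) ∧
      ContinuousOn u'' (Ioo 0 δ) ∧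
      (∀ x ∈ Ioo (0:ℝ) δ, -(1/2 : ℂ) * u'' x + (b x : ℂ) * u' x = z * u x) ∧
      Tendsto u (nhdsWithin 0 (Ioi 0)) (nhds 1) := by
  have hρpos : ∀ x, 0 < ρ x := fun x => by rw [hρ]; exact Real.exp_pos _
  have hbi : ∀ r ∈ Ioc (0:ℝ) δ, ∀ t ∈ Ioc (0:ℝ) δ,
      IntervalIntegrable (fun s => 2 * b s) volume r t := by
    intro r hr t ht
    apply ContinuousOn.intervalIntegrable
    apply ContinuousOn.mul continuousOn_const
    apply hb.mono
    intro y hy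
    rw [uIcc, mem_Icc] at hy
    exact ⟨lt_of_lt_of_le (lt_min hr.1 ht.1) hy.1, hy.2.trans (max_le hr.2 ht.2)⟩
  have hx₀' : x₀ ∈ Ioc (0:ℝ) δ := ⟨hx₀.1, hx₀.2.le⟩
  have hδ' : δ ∈ Ioc (0:ℝ) δ := ⟨hδ, le_rfl⟩
  have hρc : ∀ r ∈ Ioc (0:ℝ) δ, ContinuousOn ρ (Icc r δ) := by
    intro r hr
    have hm : min r x₀ ∈ Ioc (0:ℝ) δ := ⟨lt_min hr.1 hx₀.1, (min_le_left _ _).trans hr.2⟩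
    have h1 := intervalIntegral.continuousOn_primitive_interval' (hbi _ hm _ hδ') (a := x₀)
      (by rw [uIcc_of_le hm.2]; exact ⟨min_le_right _ _, hx₀.2.le⟩)
    rw [uIcc_of_le hm.2] at h1
    have h2 : ρ = fun x => Real.exp (-∫ s in x₀..x, 2 * b s) := funext hρ
    rw [h2]
    exact (Real.continuous_exp.comp_continuousOn h1.neg).mono
      (Icc_subset_Icc_left (min_le_left _ _))
  have hbo : ContinuousOn b (Ioo 0 δ) := hb.mono Ioo_subset_Ioc_self
  have huo : ContinuousOn u (Ioo 0 δ) := hu.mono Ioo_subset_Icc_self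
  have hρd : ∀ x ∈ Ioo (0:ℝ) δ, HasDerivAt ρ (-(2 * b x) * ρ x) x := by
    intro x hx
    have hc : ContinuousOn (fun s => 2 * b s) (Ioo 0 δ) := continuousOn_const.mul hbo
    have h1 := intervalIntegral.integral_hasDerivAt_right
      (hbi x₀ hx₀' x (Ioo_subset_Ioc_self hx))
      (hc.stronglyMeasurableAtFilter isOpen_Ioo x hx) (hc.continuousAt (isOpen_Ioo.mem_nhds hx))
    have h2 : ρ = fun x => Real.exp (-∫ s in x₀..x, 2 * b s) := funext hρ
    have h3 := h1.neg.exp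
    rw [h2]
    refine HasDerivAt.congr_deriv h3 ?_
    exact mul_comm _ _
  have hρo : ContinuousOn ρ (Ioo 0 δ) := fun x hx => (hρd x hx).continuousAt.continuousWithinAt
  set I : ℝ → ℂ := fun r => ∫ s in Ioc r δ, u s * (ρ s : ℂ) with hI
  have hId : ∀ x ∈ Ioo (0:ℝ) δ, HasDerivAt I (-(u x * (ρ x : ℂ))) x := by
    intro x hx
    have hc : ContinuousOn (fun s => u s * (ρ s : ℂ)) (Ioo 0 δ) :=
      huo.mul (Complex.continuous_ofReal.comp_continuousOn hρo)
    have hii : IntervalIntegrable (fun s => u s * (ρ s : ℂ)) volume x δ := by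
      apply ContinuousOn.intervalIntegrable
      rw [uIcc_of_le hx.2.le]
      exact (hu.mono (Icc_subset_Icc_left hx.1.le)).mul
        (Complex.continuous_ofReal.comp_continuousOn (hρc x (Ioo_subset_Ioc_self hx)))
    have h1 := intervalIntegral.integral_hasDerivAt_left hii
      (hc.stronglyMeasurableAtFilter isOpen_Ioo x hx) (hc.continuousAt (isOpen_Ioo.mem_nhds hx))
    refine h1.congr_of_eventuallyEq ?_
    filter_upwards [isOpen_Ioo.mem_nhds hx] with y hy
    rw [intervalIntegral.integral_of_le hy.2.le]
  set g : ℝ → ℂ := fun r => ((ρ r : ℂ))⁻¹ * I r with hg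
  have hgd : ∀ x ∈ Ioo (0:ℝ) δ, HasDerivAt g (2 * (b x : ℂ) * g x - u x) x := by
    intro x hx
    have hne : (ρ x : ℂ) ≠ 0 := by exact_mod_cast (hρpos x).ne'
    have h1 := ((hρd x hx).ofReal_comp.fun_inv hne).mul (hId x hx)
    refine h1.congr_deriv ?_
    simp only [hg]
    push_cast
    field_simp
    ring
  have hgo : ContinuousOn g (Ioo 0 δ) := fun x hx => (hgd x hx).continuousAt.continuousWithinAt
  have hgi : IntegrableOn g (Ioc 0 δ) := by
    rw [integrableOn_Ioc_iff_integrableOn_Ioo] at hint ⊢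
    refine Integrable.mono' hint (hgo.aestronglyMeasurable measurableSet_Ioo) ?_
    refine Eventually.of_forall fun r => ?_
    simp only [hg, hI, norm_mul, norm_inv, Complex.norm_real, Real.norm_eq_abs,
      abs_of_pos (hρpos r)]
    refine mul_le_mul_of_nonneg_left ?_ (inv_nonneg.2 (hρpos r).le)
    refine (norm_integral_le_integral_norm _).trans (le_of_eq ?_)
    congr 1
    funext s
    simp [abs_of_pos (hρpos s)]
  refine ⟨fun x => 2 * z * g x, fun x => 2 * z * (2 * (b x : ℂ) * g x - u x), ?_, ?_, ?_, ?_, ?_⟩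
  · intro x hx
    have hii : IntervalIntegrable g volume 0 x := by
      rw [intervalIntegrable_iff_integrableOn_Ioc_of_le hx.1.le]
      exact hgi.mono_set (Ioc_subset_Ioc_right hx.2.le)
    have h1 := intervalIntegral.integral_hasDerivAt_right hii
      (hgo.stronglyMeasurableAtFilter isOpen_Ioo x hx) (hgo.continuousAt (isOpen_Ioo.mem_nhds hx))
    refine ((h1.const_mul (2 * z)).const_add 1).congr_of_eventuallyEq ?_
    filter_upwards [isOpen_Ioo.mem_nhds hx] with y hy
    rw [heq y (Ioo_subset_Icc_self hy), intervalIntegral.integral_of_le hy.1.le]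
  · intro x hx
    exact (hgd x hx).const_mul (2 * z)
  · exact continuousOn_const.mul (((continuousOn_const.mul
      (Complex.continuous_ofReal.comp_continuousOn hbo)).mul hgo).sub huo)
  · intro x hx
    ring
  · have h0 : u 0 = 1 := by
      rw [heq 0 ⟨le_rfl, hδ.le⟩]
      simp
    have h1 := hu 0 ⟨le_rfl, hδ.le⟩
    rw [ContinuousWithinAt, h0] at h1
    refine h1.mono_left ?_
    rw [← nhdsWithin_Ioo_eq_nhdsGT hδ]
    exact nhdsWithin_mono _ Ioo_subset_Icc_self
end
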